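/- In the doubled frame setting, let d : U → ℝ be smooth and strictly positive on an open set U ⊆ ℝⁿ×ℝⁿ and satisfy the eikonal hypotheses. Then the ∞-Laplacian of d^{4/3} relative to the doubled frame is constant: ⟨(D_𝔷²(d^{4/3}))* · D_𝔷(d^{4/3}), D_𝔷(d^{4/3})⟩ = (4/3)⁴ at every point of U. -/

import Mathlib

open Matrix

noncomputable section

/-- Doubled frame on `ℝⁿ × ℝⁿ`: `Z (inl i) (x,y) = (Xᵢ(x), 0)` and
`Z (inr i) (x,y) = (0, Xᵢ(y))`. -/
def Zf {n : ℕ} (X : Fin n → (Fin n → ℝ) → (Fin n → ℝ)) :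
    (Fin n ⊕ Fin n) → (Fin n → ℝ) × (Fin n → ℝ) → (Fin n → ℝ) × (Fin n → ℝ)
  | Sum.inl i, p => (X i p.1, 0)
  | Sum.inr i, p => (0, X i p.2)

/-- Frame gradient `D_𝔷 d` of `d` at `p`, as a vector in `ℝ²ⁿ`. -/
def Dz {n : ℕ} (X : Fin n → (Fin n → ℝ) → (Fin n → ℝ))
    (d : (Fin n → ℝ) × (Fin n → ℝ) → ℝ) (p : (Fin n → ℝ) × (Fin n → ℝ)) :
    (Fin n ⊕ Fin n) → ℝ :=
  fun i => fderiv ℝ d p (Zf X i p)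

/-- Frame second derivative `D²_𝔷 d` of `d` at `p`: the `2n × 2n` matrix with
`(i,j)`-entry `Zᵢ(Zⱼd)(p)`. -/
def Dz2 {n : ℕ} (X : Fin n → (Fin n → ℝ) → (Fin n → ℝ))
    (d : (Fin n → ℝ) × (Fin n → ℝ) → ℝ) (p : (Fin n → ℝ) × (Fin n → ℝ)) :
    Matrix (Fin n ⊕ Fin n) (Fin n ⊕ Fin n) ℝ :=
  fun i j => fderiv ℝ (fun q => fderiv ℝ d q (Zf X j q)) p (Zf X i p)

/-- Symmetrized frame second derivative `(D²_𝔷 d)* = ½(D²_𝔷 d + (D²_𝔷 d)ᵗ)`. -/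
def Dz2Sym {n : ℕ} (X : Fin n → (Fin n → ℝ) → (Fin n → ℝ))
    (d : (Fin n → ℝ) × (Fin n → ℝ) → ℝ) (p : (Fin n → ℝ) × (Fin n → ℝ)) :
    Matrix (Fin n ⊕ Fin n) (Fin n ⊕ Fin n) ℝ :=
  (1 / 2 : ℝ) • (Dz2 X d p + (Dz2 X d p)ᵀ)

/-- The eikonal hypotheses: `Σᵢ₌₁ⁿ (Zᵢd)² = 1` and `Σᵢ₌ₙ₊₁²ⁿ (Zᵢd)² = 1` on `U`. -/
def EikonalHyp {n : ℕ} (X : Fin n → (Fin n → ℝ) → (Fin n → ℝ))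
    (d : (Fin n → ℝ) × (Fin n → ℝ) → ℝ)
    (U : Set ((Fin n → ℝ) × (Fin n → ℝ))) : Prop :=
  ∀ p ∈ U, (∑ i : Fin n, (Dz X d p (Sum.inl i)) ^ 2 = 1) ∧
    (∑ i : Fin n, (Dz X d p (Sum.inr i)) ^ 2 = 1)

theorem dotProduct_symmetrization_mulVec {ι : Type*} [Fintype ι] (A : Matrix ι ι ℝ) (v : ι → ℝ) :
    ((1 / 2 : ℝ) • (A + Aᵀ)).mulVec v ⬝ᵥ v = A.mulVec v ⬝ᵥ v := by
  have h : Aᵀ.mulVec v ⬝ᵥ v = A.mulVec v ⬝ᵥ v := by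
    rw [Matrix.mulVec_transpose, ← Matrix.dotProduct_mulVec, dotProduct_comm]
  rw [Matrix.smul_mulVec, Matrix.add_mulVec, smul_dotProduct, add_dotProduct, h, smul_eq_mul]
  ring

theorem contDiff_Zf {n : ℕ} {X : Fin n → (Fin n → ℝ) → (Fin n → ℝ)}
    (hX : ∀ i, ContDiff ℝ (⊤ : ℕ∞) (X i)) (j : Fin n ⊕ Fin n) :
    ContDiff ℝ (⊤ : ℕ∞) (Zf X j) := by
  rcases j with j | j
  · exact ((hX j).comp contDiff_fst).prodMk contDiff_const
  · exact contDiff_const.prodMk ((hX j).comp contDiff_snd)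

theorem differentiableAt_Dz {n : ℕ} {X : Fin n → (Fin n → ℝ) → (Fin n → ℝ)}
    (hX : ∀ i, ContDiff ℝ (⊤ : ℕ∞) (X i)) {f : (Fin n → ℝ) × (Fin n → ℝ) → ℝ}
    {p : (Fin n → ℝ) × (Fin n → ℝ)} (hf : ContDiffAt ℝ 2 f p) (j : Fin n ⊕ Fin n) :
    DifferentiableAt ℝ (fun q => Dz X f q j) p :=
  ((hf.fderiv_right (m := 1) (by norm_num)).differentiableAt one_ne_zero).clm_apply
    ((contDiff_Zf hX j).differentiable (by simp) p)

theorem Dz2_mulVec_Dz {n : ℕ} {X : Fin n → (Fin n → ℝ) → (Fin n → ℝ)}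
    (hX : ∀ i, ContDiff ℝ (⊤ : ℕ∞) (X i)) {f : (Fin n → ℝ) × (Fin n → ℝ) → ℝ}
    {p : (Fin n → ℝ) × (Fin n → ℝ)} (hf : ContDiffAt ℝ 2 f p) :
    (Dz2 X f p).mulVec (Dz X f p) =
      (1 / 2 : ℝ) • Dz X (fun q => ∑ j, Dz X f q j ^ 2) p := by
  have h : HasFDerivAt (fun q => ∑ j, Dz X f q j ^ 2)
      (∑ j, (2 * Dz X f p j) • fderiv ℝ (fun q => Dz X f q j) p) p :=
    HasFDerivAt.fun_sum fun j _ => by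
      simpa using (differentiableAt_Dz hX hf j).hasFDerivAt.pow 2
  funext i
  simp only [Pi.smul_apply, smul_eq_mul]
  rw [Dz, h.fderiv]
  simp only [_root_.sum_apply, _root_.smul_apply, smul_eq_mul,
    Finset.mul_sum, Matrix.mulVec, dotProduct]
  refine Finset.sum_congr rfl fun j _ => ?_
  simp only [Dz2, Dz]
  ring

theorem Dz_rpow {n : ℕ} (X : Fin n → (Fin n → ℝ) → (Fin n → ℝ))
    {d : (Fin n → ℝ) × (Fin n → ℝ) → ℝ} {p : (Fin n → ℝ) × (Fin n → ℝ)}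
    (hd : DifferentiableAt ℝ d p) (hpos : 0 < d p) (r : ℝ) :
    Dz X (fun q => d q ^ r) p = (r * d p ^ (r - 1)) • Dz X d p := by
  funext i
  simp [Dz, (hd.hasFDerivAt.rpow_const (p := r) (Or.inl hpos.ne')).fderiv]

/-- In the doubled frame setting, if `d` is smooth and strictly positive on an
open `U ⊆ ℝⁿ×ℝⁿ` and satisfies the eikonal hypotheses, then the ∞-Laplacian of `d^(4/3)`
relative to the doubled frame is constant:
`⟨(D²_𝔷(d^(4/3)))* · D_𝔷(d^(4/3)), D_𝔷(d^(4/3))⟩ = (4/3)⁴` at every point of `U`. -/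
theorem stmt7 {n : ℕ} (X : Fin n → (Fin n → ℝ) → (Fin n → ℝ))
    (hX : ∀ i, ContDiff ℝ (⊤ : ℕ∞) (X i))
    (U : Set ((Fin n → ℝ) × (Fin n → ℝ))) (hU : IsOpen U)
    (d : (Fin n → ℝ) × (Fin n → ℝ) → ℝ) (hd : ContDiffOn ℝ (⊤ : ℕ∞) d U)
    (hdpos : ∀ p ∈ U, 0 < d p)
    (heik : EikonalHyp X d U) :
    ∀ p ∈ U,
      (Dz2Sym X (fun q => d q ^ (4 / 3 : ℝ)) p).mulVec
          (Dz X (fun q => d q ^ (4 / 3 : ℝ)) p) ⬝ᵥ Dz X (fun q => d q ^ (4 / 3 : ℝ)) p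
        = (4 / 3 : ℝ) ^ 4 := by
  intro p hp
  have hdiff : ∀ q ∈ U, DifferentiableAt ℝ d q := fun q hq =>
    (hd.contDiffAt (hU.mem_nhds hq)).differentiableAt (by simp)
  have hsq : ∀ q ∈ U, ∑ j, Dz X d q j ^ 2 = 2 := fun q hq => by
    rw [Fintype.sum_sum_type, (heik q hq).1, (heik q hq).2]
    norm_num
  have hf : ContDiffAt ℝ 2 (fun q => d q ^ (4 / 3 : ℝ)) p :=
    ((hd.contDiffAt (hU.mem_nhds hp)).of_le
      (WithTop.coe_le_coe.2 (le_top : (2 : ℕ∞) ≤ ⊤))).rpow_const_of_ne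
      (hdpos p hp).ne'
  have hG : (fun q => ∑ j, Dz X (fun q => d q ^ (4 / 3 : ℝ)) q j ^ 2) =ᶠ[nhds p]
      fun q => (32 / 9 : ℝ) * d q ^ (2 / 3 : ℝ) := by
    filter_upwards [hU.mem_nhds hp] with q hq
    have hpow : (d q ^ (1 / 3 : ℝ)) ^ 2 = d q ^ (2 / 3 : ℝ) := by
      rw [← Real.rpow_mul_natCast (hdpos q hq).le]
      norm_num
    simp only [Dz_rpow X (hdiff q hq) (hdpos q hq), Pi.smul_apply, smul_eq_mul, mul_pow]
    rw [← Finset.mul_sum, hsq q hq, show (4 / 3 - 1 : ℝ) = 1 / 3 by norm_num, hpow]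
    ring
  have hDG : Dz X (fun q => ∑ j, Dz X (fun q => d q ^ (4 / 3 : ℝ)) q j ^ 2) p =
      (64 / 27 * d p ^ (-(1 / 3) : ℝ)) • Dz X d p := by
    have h := ((hdiff p hp).hasFDerivAt.rpow_const (p := (2 / 3 : ℝ))
      (Or.inl (hdpos p hp).ne')).const_mul (32 / 9 : ℝ)
    funext i
    rw [Dz, hG.fderiv_eq, h.fderiv, show (2 / 3 - 1 : ℝ) = -(1 / 3) by norm_num]
    simp only [_root_.smul_apply, Pi.smul_apply, smul_eq_mul, Dz]
    ring
  have hinv : d p ^ (-(1 / 3) : ℝ) * d p ^ (1 / 3 : ℝ) = 1 := by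
    rw [← Real.rpow_add (hdpos p hp)]
    simp
  have hdot : Dz X d p ⬝ᵥ Dz X d p = 2 := by
    simpa only [dotProduct, ← sq] using hsq p hp
  rw [Dz2Sym, dotProduct_symmetrization_mulVec, Dz2_mulVec_Dz hX hf, hDG,
    Dz_rpow X (hdiff p hp) (hdpos p hp), show (4 / 3 - 1 : ℝ) = 1 / 3 by norm_num]
  simp only [smul_dotProduct, dotProduct_smul, hdot, smul_eq_mul]
  linear_combination (256 / 81 : ℝ) * hinv
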